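/- Let φ be a (2,3)-CNF formula with n variables (each clause exactly two literals, each variable in at least 2 and at most 3 clauses), and let T_φ be the Tournament Value Maximization instance obtained from φ by Construction 1. Then the maximum tournament value over all tournament seedings of T_φ equals the maximum number of simultaneously satisfiable clauses of φ plus n. -/

import Mathlib

/-- Players are natural numbers; player `i` beats player `j` iff `i > j`.
Hence the winner of a (sub)tournament is its strongest player, i.e. the maximum
of the list of participating players. -/
def winner (l : List ℕ) : ℕ := l.foldr max 0

/-- The tournament value of the seeding given by the list `l` of players in
seed-position order (`l.length = 2 ^ m`), with respect to the game-value
function `v`: the value of a tournament on a single player is `0`; otherwise it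
is the value of the subtournament of the first half of the seed positions, plus
the value of the subtournament of the second half, plus `v i₁ i₂ m` where
`i₁, i₂` are the winners of the two halves playing each other in the final
round `m`. -/
def tourValue (v : ℕ → ℕ → ℕ → ℤ) : ℕ → List ℕ → ℤ
  | 0, _ => 0
  | m + 1, l =>
      tourValue v m (l.take (2 ^ m)) + tourValue v m (l.drop (2 ^ m)) +
        v (winner (l.take (2 ^ m))) (winner (l.drop (2 ^ m))) (m + 1)

/-- `l` is a tournament seeding for the player set `N` iff `l` lists the
elements of `N`, each exactly once, in seed-position order. -/
def IsSeeding (N : Finset ℕ) (l : List ℕ) : Prop := l.Nodup ∧ l.toFinset = N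

/-- The number of games won by player `i` in the tournament with `m` rounds on
the seeding `l`: in each (sub)tournament, the final game is won by the stronger
of the winners of the two halves. -/
def winCount (i : ℕ) : ℕ → List ℕ → ℕ
  | 0, _ => 0
  | m + 1, l =>
      winCount i m (l.take (2 ^ m)) + winCount i m (l.drop (2 ^ m)) +
        if i = max (winner (l.take (2 ^ m))) (winner (l.drop (2 ^ m))) then 1 else 0

/-- A clause with exactly two literals; a literal is a pair
(variable, polarity). -/
abbrev Clause2 := (ℕ × Bool) × (ℕ × Bool)

/-- The assignment `α` satisfies the clause `c` if it makes at least one of its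
two literals true. -/
def clauseSat (α : ℕ → Bool) (c : Clause2) : Bool :=
  (α c.1.1 == c.1.2) || (α c.2.1 == c.2.2)

/-- The number of clauses of `cs` satisfied by the assignment `α`. -/
def satCount (α : ℕ → Bool) (cs : List Clause2) : ℕ := cs.countP (clauseSat α)

/-- The list of all literal occurrences of the formula, in order. -/
def lits (cs : List Clause2) : List (ℕ × Bool) :=
  cs.foldr (fun c acc => c.1 :: c.2 :: acc) []

/-- `cs` is a (2,3)-CNF formula on the variables `1, …, n`: each clause has two
literals on two distinct variables from `{1, …, n}`, and each variable occurs
(equivalently, appears in) at least `2` and at most `3` clauses. -/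
def Good23 (n : ℕ) (cs : List Clause2) : Prop :=
  (∀ c ∈ cs, 1 ≤ c.1.1 ∧ c.1.1 ≤ n ∧ 1 ≤ c.2.1 ∧ c.2.1 ≤ n ∧ c.1.1 ≠ c.2.1) ∧
  (∀ x : ℕ, 1 ≤ x → x ≤ n →
      2 ≤ (lits cs).countP (fun p => p.1 == x) ∧
        (lits cs).countP (fun p => p.1 == x) ≤ 3)

/-- The total number of players `2 ^ n'`, where `n'` is the smallest integer
with `16 * n ≤ 2 ^ n'`.  The player set is `{0, 1, …, numP n - 1}` and the
`k`-th strongest player is the number `numP n - k`. -/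
def numP (n : ℕ) : ℕ := 2 ^ Nat.clog 2 (16 * n)

/-- The variable player `x_i` (`i ∈ {1, …, n}`), of strength rank `3*i - 2`. -/
def xPl (n i : ℕ) : ℕ := numP n - (3 * i - 2)

/-- The variable player `x_i^T`, of strength rank `3*i - 1`. -/
def xTPl (n i : ℕ) : ℕ := numP n - (3 * i - 1)

/-- The variable player `x_i^F`, of strength rank `3*i`. -/
def xFPl (n i : ℕ) : ℕ := numP n - (3 * i)

/-- The clause player `c_j` (`j ∈ {1, …, m}`), of strength rank `3*n + j`;
the remaining numbers are the dummy players `f_1, …, f_{13n+p-m}`. -/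
def cPl (n j : ℕ) : ℕ := numP n - (3 * n + j)

/-- The variable player corresponding to a literal: `x_i^T` for a positive and
`x_i^F` for a negative occurrence of `x_i`. -/
def litPl (n : ℕ) (p : ℕ × Bool) : ℕ := if p.2 then xTPl n p.1 else xFPl n p.1

/-- The games of value `1` of Construction 1 (before symmetrisation):
`v (x_i) (x_i^T) 1 = v (x_i) (x_i^F) 1 = 1`, and for the `t`-th literal
occurrence of the formula (belonging to clause number `t / 2 + 1`), on the
variable `x_i` with polarity `b`, being the `j`-th occurrence of `x_i` in the
formula, the game of `c_{t/2+1}` against `x_i^T` (if `b` is positive) resp.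
`x_i^F` (if `b` is negative) in round `j` has value `1`. -/
def Gv1Core (n : ℕ) (cs : List Clause2) (a b r : ℕ) : Prop :=
  (∃ i : ℕ, 1 ≤ i ∧ i ≤ n ∧ a = xPl n i ∧ (b = xTPl n i ∨ b = xFPl n i) ∧ r = 1) ∨
  (∃ t : ℕ, t < (lits cs).length ∧
      a = cPl n (t / 2 + 1) ∧ b = litPl n ((lits cs).getD t (0, true)) ∧
      r = 1 + ((lits cs).take t).countP
          (fun p => p.1 == ((lits cs).getD t (0, true)).1))

open Classical in
/-- The (symmetric) game-value function of Construction 1: value `1` for the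
games described by `Gv1Core`, value `0` for all other games. -/
noncomputable def gv1 (n : ℕ) (cs : List Clause2) (a b r : ℕ) : ℤ :=
  if Gv1Core n cs a b r ∨ Gv1Core n cs b a r then 1 else 0

/-- The strongest player in the `q`-th block of `2 ^ r` consecutive seed positions. -/
def blockMax (f : ℕ → ℕ) : ℕ → ℕ → ℕ
  | 0, q => f q
  | r + 1, q => max (blockMax f r (2 * q)) (blockMax f r (2 * q + 1))

/-- The games of a tournament with `m` rounds: `⟨r, q⟩` is the `q`-th game of round `r + 1`. -/
def games (m : ℕ) : Finset (Σ _ : ℕ, ℕ) :=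
  (Finset.range m).sigma fun r => Finset.range (2 ^ (m - 1 - r))

/-- Player `u` takes part in the `q`-th game of round `r + 1`. -/
def Plays (f : ℕ → ℕ) (u r q : ℕ) : Prop :=
  u = blockMax f r (2 * q) ∨ u = blockMax f r (2 * q + 1)

theorem winner_append (l₁ l₂ : List ℕ) :
    winner (l₁ ++ l₂) = max (winner l₁) (winner l₂) := by
  induction l₁ with
  | nil => simp [winner]
  | cons a l ih =>
    have h : ∀ b l, winner (b :: l) = max b (winner l) := fun _ _ => rfl
    rw [List.cons_append, h, h, ih, max_assoc]

theorem winner_eq_blockMax (f : ℕ → ℕ) (r : ℕ) : ∀ (q : ℕ) (l : List ℕ), l.length = 2 ^ r →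
    (∀ p < 2 ^ r, l.getD p 0 = f (q * 2 ^ r + p)) → winner l = blockMax f r q := by
  induction r with
  | zero =>
    intro q l hl hf
    obtain ⟨a, rfl⟩ := List.length_eq_one_iff.1 (by simpa using hl)
    have := hf 0 (by simp)
    simpa [winner, blockMax] using this
  | succ r ih =>
    intro q l hl hf
    rw [pow_succ] at hl
    rw [← List.take_append_drop (2 ^ r) l, winner_append, blockMax]
    congr 1
    · refine ih _ _ (by rw [List.length_take]; omega) fun p hp => ?_
      have := hf p (by rw [pow_succ]; omega)
      rw [show 2 * q * 2 ^ r + p = q * 2 ^ (r + 1) + p by ring, ← this]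
      simp [List.getD, hp]
    · refine ih _ _ (by rw [List.length_drop]; omega) fun p hp => ?_
      have := hf (2 ^ r + p) (by rw [pow_succ]; omega)
      rw [show (2 * q + 1) * 2 ^ r + p = q * 2 ^ (r + 1) + (2 ^ r + p) by ring, ← this]
      simp [List.getD, List.getElem?_drop]

theorem tourValue_eq_sum_Ico (v : ℕ → ℕ → ℕ → ℤ) (f : ℕ → ℕ) (m : ℕ) :
    ∀ (q : ℕ) (l : List ℕ), l.length = 2 ^ m →
    (∀ p < 2 ^ m, l.getD p 0 = f (q * 2 ^ m + p)) →
    tourValue v m l = ∑ r ∈ Finset.range m,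
      ∑ s ∈ Finset.Ico (q * 2 ^ (m - 1 - r)) ((q + 1) * 2 ^ (m - 1 - r)),
        v (blockMax f r (2 * s)) (blockMax f r (2 * s + 1)) (r + 1) := by
  induction m with
  | zero => intro q l _ _; simp [tourValue]
  | succ m ih =>
    intro q l hl hf
    rw [pow_succ] at hl
    have hl₁ : (l.take (2 ^ m)).length = 2 ^ m := by rw [List.length_take]; omega
    have hl₂ : (l.drop (2 ^ m)).length = 2 ^ m := by rw [List.length_drop]; omega
    have hf₁ : ∀ p < 2 ^ m, (l.take (2 ^ m)).getD p 0 = f (2 * q * 2 ^ m + p) := by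
      intro p hp
      have := hf p (by rw [pow_succ]; omega)
      rw [show 2 * q * 2 ^ m + p = q * 2 ^ (m + 1) + p by ring, ← this]
      simp [List.getD, hp]
    have hf₂ : ∀ p < 2 ^ m, (l.drop (2 ^ m)).getD p 0 = f ((2 * q + 1) * 2 ^ m + p) := by
      intro p hp
      have := hf (2 ^ m + p) (by rw [pow_succ]; omega)
      rw [show (2 * q + 1) * 2 ^ m + p = q * 2 ^ (m + 1) + (2 ^ m + p) by ring, ← this]
      simp [List.getD, List.getElem?_drop]
    rw [tourValue, ih _ _ hl₁ hf₁, ih _ _ hl₂ hf₂, winner_eq_blockMax f m _ _ hl₁ hf₁,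
      winner_eq_blockMax f m _ _ hl₂ hf₂, Finset.sum_range_succ, ← Finset.sum_add_distrib]
    congr 1
    · refine Finset.sum_congr rfl fun r hr => ?_
      have hr := Finset.mem_range.1 hr
      have e : m + 1 - 1 - r = (m - 1 - r) + 1 := by omega
      rw [e, Finset.sum_Ico_consecutive]
      · congr 1
        rw [pow_succ]
        congr 1 <;> ring
      · gcongr; omega
      · gcongr; omega
    · simp

theorem tourValue_eq_sum (v : ℕ → ℕ → ℕ → ℤ) (m : ℕ) (l : List ℕ) (hl : l.length = 2 ^ m) :
    tourValue v m l = ∑ g ∈ games m, v (blockMax (l.getD · 0) g.1 (2 * g.2))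
      (blockMax (l.getD · 0) g.1 (2 * g.2 + 1)) (g.1 + 1) := by
  rw [tourValue_eq_sum_Ico v (l.getD · 0) m 0 l hl (by simp), games, Finset.sum_sigma]
  simp

theorem exists_eq_blockMax (f : ℕ → ℕ) (r : ℕ) :
    ∀ q, ∃ p, p / 2 ^ r = q ∧ blockMax f r q = f p := by
  induction r with
  | zero => intro q; exact ⟨q, by simp, rfl⟩
  | succ r ih =>
    intro q
    rw [blockMax]
    obtain ⟨p₁, h₁, e₁⟩ := ih (2 * q)
    obtain ⟨p₂, h₂, e₂⟩ := ih (2 * q + 1)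
    rcases max_choice (blockMax f r (2 * q)) (blockMax f r (2 * q + 1)) with h | h
    · exact ⟨p₁, by rw [pow_succ, ← Nat.div_div_eq_div_mul, h₁]; omega, by rw [h, e₁]⟩
    · exact ⟨p₂, by rw [pow_succ, ← Nat.div_div_eq_div_mul, h₂]; omega, by rw [h, e₂]⟩

theorem blockMax_le_succ (f : ℕ → ℕ) (r p : ℕ) :
    blockMax f r (p / 2 ^ r) ≤ blockMax f (r + 1) (p / 2 ^ (r + 1)) := by
  rw [blockMax, pow_succ, ← Nat.div_div_eq_div_mul]
  rcases Nat.mod_two_eq_zero_or_one (p / 2 ^ r) with h | h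
  · rw [show 2 * (p / 2 ^ r / 2) = p / 2 ^ r by omega]; exact le_max_left _ _
  · rw [show 2 * (p / 2 ^ r / 2) + 1 = p / 2 ^ r by omega]; exact le_max_right _ _

theorem blockMax_mono (f : ℕ → ℕ) (p : ℕ) : Monotone fun r => blockMax f r (p / 2 ^ r) :=
  monotone_nat_of_le_succ fun r => blockMax_le_succ f r p

theorem le_blockMax (f : ℕ → ℕ) (r p : ℕ) : f p ≤ blockMax f r (p / 2 ^ r) := by
  simpa [blockMax] using blockMax_mono f p (Nat.zero_le r)

theorem mem_games {m r q : ℕ} : (⟨r, q⟩ : Σ _ : ℕ, ℕ) ∈ games m ↔ r < m ∧ q < 2 ^ (m - 1 - r) := by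
  simp [games]

theorem lt_of_mem_games {m r q p : ℕ} (h : (⟨r, q⟩ : Σ _ : ℕ, ℕ) ∈ games m)
    (hp : p / 2 ^ (r + 1) = q) : p < 2 ^ m := by
  obtain ⟨hr, hq⟩ := mem_games.1 h
  rw [← hp, Nat.div_lt_iff_lt_mul (by positivity), ← pow_add] at hq
  rwa [show m - 1 - r + (r + 1) = m by omega] at hq

theorem mem_games_of_mul_lt {m r q : ℕ} (hr : r < m) (h : q * 2 ^ (r + 1) < 2 ^ m) :
    (⟨r, q⟩ : Σ _ : ℕ, ℕ) ∈ games m := by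
  refine mem_games.2 ⟨hr, ?_⟩
  have e : 2 ^ m = 2 ^ (m - 1 - r) * 2 ^ (r + 1) := by
    rw [← pow_add, show m - 1 - r + (r + 1) = m by omega]
  rw [e] at h
  exact lt_of_mul_lt_mul_right h (Nat.zero_le _)

theorem Plays.exists_pos {f : ℕ → ℕ} {u r q : ℕ} (h : Plays f u r q) :
    ∃ p, p / 2 ^ (r + 1) = q ∧ f p = u ∧ u = blockMax f r (p / 2 ^ r) := by
  rcases h with h | h
  · obtain ⟨p, hp, e⟩ := exists_eq_blockMax f r (2 * q)
    exact ⟨p, by rw [pow_succ, ← Nat.div_div_eq_div_mul, hp]; omega, by rw [h, e], by rw [hp, h]⟩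
  · obtain ⟨p, hp, e⟩ := exists_eq_blockMax f r (2 * q + 1)
    exact ⟨p, by rw [pow_succ, ← Nat.div_div_eq_div_mul, hp]; omega, by rw [h, e], by rw [hp, h]⟩

theorem Plays.le_blockMax {f : ℕ → ℕ} {u r q : ℕ} (h : Plays f u r q) :
    u ≤ blockMax f (r + 1) q := by
  rw [blockMax]
  rcases h with h | h <;> rw [h]
  · exact le_max_left _ _
  · exact le_max_right _ _

/-- In each round a player takes part in at most one game. -/
theorem Plays.unique {f : ℕ → ℕ} {m u r q q' : ℕ} (hf : Set.InjOn f (Set.Iio (2 ^ m)))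
    (hg : (⟨r, q⟩ : Σ _ : ℕ, ℕ) ∈ games m) (hg' : (⟨r, q'⟩ : Σ _ : ℕ, ℕ) ∈ games m)
    (h : Plays f u r q) (h' : Plays f u r q') : q = q' := by
  obtain ⟨p, hp, e, -⟩ := h.exists_pos
  obtain ⟨p', hp', e', -⟩ := h'.exists_pos
  have := hf (lt_of_mem_games hg hp) (lt_of_mem_games hg' hp') (e.trans e'.symm)
  rw [← hp, ← hp', this]

/-- A player does not take part in any game after a lost one. -/
theorem Plays.round_le_of_lt {f : ℕ → ℕ} {m u w r q r' q' : ℕ} (hf : Set.InjOn f (Set.Iio (2 ^ m)))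
    (hg : (⟨r, q⟩ : Σ _ : ℕ, ℕ) ∈ games m) (hg' : (⟨r', q'⟩ : Σ _ : ℕ, ℕ) ∈ games m)
    (h : Plays f u r q) (hw : Plays f w r q) (huw : u < w) (h' : Plays f u r' q') : r' ≤ r := by
  by_contra! hr
  obtain ⟨p, hp, e, -⟩ := h.exists_pos
  obtain ⟨p', hp', e', e₂⟩ := h'.exists_pos
  obtain rfl := hf (lt_of_mem_games hg hp) (lt_of_mem_games hg' hp') (e.trans e'.symm)
  have h₁ := blockMax_mono f p (show r + 1 ≤ r' from hr)
  have h₂ := hw.le_blockMax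
  simp only [hp] at h₁
  omega

/-- A player loses at most one game. -/
theorem Plays.unique_of_lt {f : ℕ → ℕ} {m u w w' r q r' q' : ℕ}
    (hf : Set.InjOn f (Set.Iio (2 ^ m)))
    (hg : (⟨r, q⟩ : Σ _ : ℕ, ℕ) ∈ games m) (hg' : (⟨r', q'⟩ : Σ _ : ℕ, ℕ) ∈ games m)
    (h : Plays f u r q) (hw : Plays f w r q) (huw : u < w)
    (h' : Plays f u r' q') (hw' : Plays f w' r' q') (huw' : u < w') :
    (⟨r, q⟩ : Σ _ : ℕ, ℕ) = ⟨r', q'⟩ := by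
  obtain rfl := le_antisymm (h'.round_le_of_lt hf hg' hg hw' huw' h)
    (h.round_le_of_lt hf hg hg' hw huw h')
  rw [h.unique hf hg hg' h']

theorem IsSeeding.length_eq {N : ℕ} {l : List ℕ} (h : IsSeeding (Finset.range N) l) :
    l.length = N := by
  rw [← List.toFinset_card_of_nodup h.1, h.2, Finset.card_range]

theorem IsSeeding.injOn {N : ℕ} {l : List ℕ} (h : IsSeeding (Finset.range N) l) :
    Set.InjOn (l.getD · 0) (Set.Iio N) := by
  intro p hp p' hp' e
  have hl := h.length_eq
  simp only [Set.mem_Iio, ← hl] at hp hp'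
  simp only [List.getD_eq_getElem _ _ hp, List.getD_eq_getElem _ _ hp'] at e
  exact (h.1.getElem_inj_iff).1 e

theorem IsSeeding.getD_lt {N : ℕ} {l : List ℕ} (h : IsSeeding (Finset.range N) l) {p : ℕ}
    (hp : p < N) : l.getD p 0 < N := by
  rw [← h.length_eq] at hp
  rw [List.getD_eq_getElem _ _ hp, ← Finset.mem_range, ← h.2, List.mem_toFinset]
  exact List.getElem_mem hp

/-- Any injective placement of some of the players extends to a seeding. -/
theorem exists_isSeeding_extend (N : ℕ) (s : Finset ℕ) (hs : s ⊆ Finset.range N) (pos : ℕ → ℕ)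
    (hpos : ∀ u ∈ s, pos u < N) (hinj : Set.InjOn pos s) :
    ∃ l, IsSeeding (Finset.range N) l ∧ ∀ u ∈ s, l.getD (pos u) 0 = u := by
  obtain ⟨g, hg⟩ := Finset.exists_equiv_extend_of_card_eq (α := Fin N) (t := Finset.range N)
    (by simp) (s := Finset.univ.filter fun u : Fin N => (u : ℕ) ∈ s) (f := fun u => pos u)
    (by
      intro p hp
      simp only [Finset.mem_image, Finset.mem_filter, Finset.mem_univ, true_and] at hp
      obtain ⟨u, hu, rfl⟩ := hp
      exact Finset.mem_range.2 (hpos _ hu))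
    (by
      intro u hu u' hu' e
      simp only [Finset.coe_filter, Finset.mem_univ, true_and, Set.mem_ofPred_eq] at hu hu'
      exact Fin.ext (hinj hu hu' e))
  refine ⟨List.ofFn fun p : Fin N => (g.symm ⟨p, Finset.mem_range.2 p.2⟩ : ℕ), ⟨?_, ?_⟩, ?_⟩
  · rw [List.nodup_ofFn]
    intro p p' e
    have := g.symm.injective (Fin.ext e)
    exact Fin.ext (congrArg Subtype.val this)
  · ext u
    simp only [List.mem_toFinset, List.mem_ofFn, Finset.mem_range]
    constructor
    · rintro ⟨p, rfl⟩
      exact Fin.is_lt _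
    · intro hu
      exact ⟨⟨g ⟨u, hu⟩, Finset.mem_range.1 (g ⟨u, hu⟩).2⟩, by simp⟩
  · intro u hu
    have huN := Finset.mem_range.1 (hs hu)
    have hp : pos u < N := hpos u hu
    rw [List.getD_eq_getElem _ _ (by simpa using hp), List.getElem_ofFn]
    have : g ⟨u, huN⟩ = ⟨pos u, Finset.mem_range.2 hp⟩ :=
      Subtype.ext (hg ⟨u, huN⟩ (by simpa using hu))
    simp [← this]

/-- The `t`-th literal occurrence of the formula. -/
def litAt (cs : List Clause2) (t : ℕ) : ℕ × Bool := (lits cs).getD t (0, true)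

/-- The number of occurrences of the variable of the `t`-th literal before that literal. -/
def prevOcc (cs : List Clause2) (t : ℕ) : ℕ :=
  ((lits cs).take t).countP fun p => p.1 == (litAt cs t).1

theorem lits_cons (c : Clause2) (cs : List Clause2) : lits (c :: cs) = c.1 :: c.2 :: lits cs := rfl

theorem length_lits (cs : List Clause2) : (lits cs).length = 2 * cs.length := by
  induction cs with
  | nil => rfl
  | cons c cs ih => rw [lits_cons, List.length_cons, List.length_cons, ih, List.length_cons]; ring

theorem litAt_two_mul {cs : List Clause2} : ∀ {k : ℕ} (hk : k < cs.length),
    litAt cs (2 * k) = cs[k].1 ∧ litAt cs (2 * k + 1) = cs[k].2 := by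
  induction cs with
  | nil => intro k hk; simp at hk
  | cons c cs ih =>
    intro k hk
    cases k with
    | zero => simp [litAt, lits_cons]
    | succ k =>
      have := ih (k := k) (by simpa using hk)
      simpa [litAt, lits_cons, mul_add] using this

theorem satCount_eq_card (α : ℕ → Bool) (cs : List Clause2) :
    satCount α cs = ((Finset.range cs.length).filter fun k =>
      (litAt cs (2 * k)).2 = α (litAt cs (2 * k)).1 ∨
        (litAt cs (2 * k + 1)).2 = α (litAt cs (2 * k + 1)).1).card := by
  have h : ∀ cs : List Clause2, satCount α cs = ∑ k ∈ Finset.range cs.length,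
      if (litAt cs (2 * k)).2 = α (litAt cs (2 * k)).1 ∨
        (litAt cs (2 * k + 1)).2 = α (litAt cs (2 * k + 1)).1 then 1 else 0 := by
    intro cs
    induction cs with
    | nil => rfl
    | cons c cs ih =>
      rw [satCount, List.countP_cons, ← satCount, ih, List.length_cons, Finset.sum_range_succ']
      congr 1
      simp [clauseSat, litAt, lits_cons, eq_comm (a := α _)]
  rw [h, Finset.card_filter]

theorem prevOcc_lt {cs : List Clause2} {t t' : ℕ} (h : t < t') (ht' : t' < (lits cs).length)
    (e : (litAt cs t).1 = (litAt cs t').1) : prevOcc cs t < prevOcc cs t' := by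
  have h₁ : ((lits cs).take (t + 1)).countP (fun p => p.1 == (litAt cs t).1) = prevOcc cs t + 1 := by
    rw [List.take_add_one, List.countP_append, prevOcc, List.getElem?_eq_getElem (h.trans ht')]
    simp [litAt, List.getElem?_eq_getElem (h.trans ht')]
  have h₂ : ((lits cs).take (t + 1)).countP (fun p => p.1 == (litAt cs t).1) ≤ prevOcc cs t' := by
    rw [prevOcc, e]
    exact (List.take_sublist_take_left (by omega)).countP_le
  omega

theorem prevOcc_inj {cs : List Clause2} {t t' : ℕ} (ht : t < (lits cs).length)
    (ht' : t' < (lits cs).length) (e : (litAt cs t).1 = (litAt cs t').1)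
    (h : prevOcc cs t = prevOcc cs t') : t = t' := by
  rcases lt_trichotomy t t' with h' | h' | h'
  · have := prevOcc_lt h' ht' e; omega
  · exact h'
  · have := prevOcc_lt h' ht e.symm; omega

theorem Good23.litAt_mem {n : ℕ} {cs : List Clause2} (h : Good23 n cs) {t : ℕ}
    (ht : t < (lits cs).length) : 1 ≤ (litAt cs t).1 ∧ (litAt cs t).1 ≤ n := by
  rw [length_lits] at ht
  have hk : t / 2 < cs.length := by omega
  obtain ⟨h₁, h₂, h₃, h₄, -⟩ := h.1 _ (List.getElem_mem hk)
  obtain ⟨e₁, e₂⟩ := litAt_two_mul hk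
  rcases Nat.mod_two_eq_zero_or_one t with h' | h'
  · rw [show 2 * (t / 2) = t by omega] at e₁
    rw [e₁]; exact ⟨h₁, h₂⟩
  · rw [show 2 * (t / 2) + 1 = t by omega] at e₂
    rw [e₂]; exact ⟨h₃, h₄⟩

theorem Good23.prevOcc_le {n : ℕ} {cs : List Clause2} (h : Good23 n cs) {t : ℕ}
    (ht : t < (lits cs).length) : prevOcc cs t ≤ 2 := by
  obtain ⟨h₁, h₂⟩ := h.litAt_mem ht
  have h₃ := (h.2 _ h₁ h₂).2
  have h₄ : ((lits cs).take (t + 1)).countP (fun p => p.1 == (litAt cs t).1) = prevOcc cs t + 1 := by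
    rw [List.take_add_one, List.countP_append, prevOcc, List.getElem?_eq_getElem ht]
    simp [litAt, List.getElem?_eq_getElem ht]
  have h₅ := (List.take_sublist (t + 1) (lits cs)).countP_le (p := fun p => p.1 == (litAt cs t).1)
  omega

theorem Good23.length_le {n : ℕ} {cs : List Clause2} (h : Good23 n cs) :
    2 * cs.length ≤ 3 * n := by
  rw [← length_lits]
  have h₁ := Finset.card_le_card_of_injOn (s := Finset.range (lits cs).length)
    (t := Finset.Icc 1 n ×ˢ Finset.range 3) (fun t => ((litAt cs t).1, prevOcc cs t))
    (fun t ht => by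
      have ht := Finset.mem_range.1 ht
      have h₁ := h.litAt_mem ht
      have h₂ := h.prevOcc_le ht
      simp only [Finset.coe_product, Set.mem_prod, Finset.coe_Icc, Set.mem_Icc, Finset.coe_range,
        Set.mem_Iio]
      omega)
    (fun t ht t' ht' e => by
      simp only [Finset.coe_range, Set.mem_Iio] at ht ht'
      obtain ⟨e₁, e₂⟩ := Prod.mk.inj e
      exact prevOcc_inj ht ht' e₁ e₂)
  simp only [Finset.card_range, Finset.card_product, Nat.card_Icc] at h₁
  omega

theorem Good23.le_numP {n : ℕ} {cs : List Clause2} (h : Good23 n cs) :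
    16 * n ≤ numP n ∧ 3 * n + cs.length < numP n := by
  have h₁ : 16 * n ≤ numP n := Nat.le_pow_clog (by norm_num) _
  have h₂ : 0 < numP n := by unfold numP; positivity
  have h₃ := h.length_le
  omega

/-- Each variable has a polarity from which at most one of its occurrences deviates. -/
theorem Good23.exists_majority {n : ℕ} {cs : List Clause2} (h : Good23 n cs) (x : ℕ) :
    ∃ b : Bool, ∀ t t', t < (lits cs).length → t' < (lits cs).length → (litAt cs t).1 = x →
      (litAt cs t').1 = x → (litAt cs t).2 ≠ b → (litAt cs t').2 ≠ b → t = t' := by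
  by_contra! hc
  obtain ⟨t₁, t₂, l₁, l₂, x₁, x₂, b₁, b₂, d₁⟩ := hc true
  obtain ⟨t₃, t₄, l₃, l₄, x₃, x₄, b₃, b₄, d₂⟩ := hc false
  have d₃ : t₁ ≠ t₃ := by rintro rfl; simp_all
  have d₄ : t₁ ≠ t₄ := by rintro rfl; simp_all
  have d₅ : t₂ ≠ t₃ := by rintro rfl; simp_all
  have d₆ : t₂ ≠ t₄ := by rintro rfl; simp_all
  have key : ∀ {t t'}, t < (lits cs).length → t' < (lits cs).length → (litAt cs t).1 = x →
      (litAt cs t').1 = x → t ≠ t' → prevOcc cs t ≠ prevOcc cs t' :=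
    fun ht ht' e e' hne hp => hne (prevOcc_inj ht ht' (e.trans e'.symm) hp)
  have := key l₁ l₂ x₁ x₂ d₁
  have := key l₃ l₄ x₃ x₄ d₂
  have := key l₁ l₃ x₁ x₃ d₃
  have := key l₁ l₄ x₁ x₄ d₄
  have := key l₂ l₃ x₂ x₃ d₅
  have := key l₂ l₄ x₂ x₄ d₆
  have := h.prevOcc_le l₁
  have := h.prevOcc_le l₂
  have := h.prevOcc_le l₃
  have := h.prevOcc_le l₄
  omega

/-- The game of round `r + 1` between the players `a` and `b` has value `1`. -/
def Scores (n : ℕ) (cs : List Clause2) (a b r : ℕ) : Prop :=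
  Gv1Core n cs a b (r + 1) ∨ Gv1Core n cs b a (r + 1)

open Classical in
theorem tourValue_gv1 (n : ℕ) (cs : List Clause2) (m : ℕ) (l : List ℕ) (hl : l.length = 2 ^ m) :
    tourValue (gv1 n cs) m l = ((games m).filter fun g => Scores n cs
      (blockMax (l.getD · 0) g.1 (2 * g.2)) (blockMax (l.getD · 0) g.1 (2 * g.2 + 1)) g.1).card := by
  rw [tourValue_eq_sum _ _ _ hl, ← Finset.sum_boole]
  refine Finset.sum_congr rfl fun g _ => ?_
  unfold gv1 Scores
  congr

theorem gv1Core_iff {n : ℕ} {cs : List Clause2} {a b r : ℕ} : Gv1Core n cs a b (r + 1) ↔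
    (∃ i s, 1 ≤ i ∧ i ≤ n ∧ a = xPl n i ∧ b = litPl n (i, s) ∧ r = 0) ∨
    ∃ t < (lits cs).length, a = cPl n (t / 2 + 1) ∧ b = litPl n (litAt cs t) ∧
      r = prevOcc cs t := by
  unfold Gv1Core
  refine or_congr ⟨?_, ?_⟩ (exists_congr fun t => and_congr Iff.rfl (and_congr Iff.rfl
    (and_congr Iff.rfl ?_)))
  · rintro ⟨i, h₁, h₂, ha, hb | hb, hr⟩
    · exact ⟨i, true, h₁, h₂, ha, by simpa [litPl] using hb, by omega⟩
    · exact ⟨i, false, h₁, h₂, ha, by simpa [litPl] using hb, by omega⟩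
  · rintro ⟨i, s, h₁, h₂, ha, hb, hr⟩
    refine ⟨i, h₁, h₂, ha, ?_, by omega⟩
    cases s <;> simp_all [litPl]
  · unfold prevOcc litAt
    omega

theorem Scores.cases {n : ℕ} {cs : List Clause2} {f : ℕ → ℕ} {r q : ℕ}
    (h : Scores n cs (blockMax f r (2 * q)) (blockMax f r (2 * q + 1)) r) :
    (∃ i s, 1 ≤ i ∧ i ≤ n ∧ Plays f (xPl n i) r q ∧ Plays f (litPl n (i, s)) r q ∧ r = 0) ∨
    ∃ t < (lits cs).length, Plays f (cPl n (t / 2 + 1)) r q ∧ Plays f (litPl n (litAt cs t)) r q := by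
  rcases h with h | h <;> rw [gv1Core_iff] at h <;>
    rcases h with ⟨i, s, h₁, h₂, h₃, h₄, h₅⟩ | ⟨t, h₁, h₂, h₃, h₄⟩
  · exact Or.inl ⟨i, s, h₁, h₂, Or.inl h₃.symm, Or.inr h₄.symm, h₅⟩
  · exact Or.inr ⟨t, h₁, Or.inl h₂.symm, Or.inr h₃.symm⟩
  · exact Or.inl ⟨i, s, h₁, h₂, Or.inr h₃.symm, Or.inl h₄.symm, h₅⟩
  · exact Or.inr ⟨t, h₁, Or.inr h₂.symm, Or.inl h₃.symm⟩

theorem litPl_lt_xPl {n : ℕ} {cs : List Clause2} (h : Good23 n cs) {i : ℕ} (hi : 1 ≤ i)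
    (hn : i ≤ n) (s : Bool) : litPl n (i, s) < xPl n i := by
  have := h.le_numP
  cases s <;> simp only [litPl, xPl, xTPl, xFPl] <;> simp <;> omega

theorem cPl_lt_litPl {n : ℕ} {cs : List Clause2} (h : Good23 n cs) {i : ℕ} (hi : 1 ≤ i)
    (hn : i ≤ n) (s : Bool) (k : ℕ) : cPl n (k + 1) < litPl n (i, s) := by
  have := h.le_numP
  cases s <;> simp only [litPl, cPl, xTPl, xFPl] <;> simp <;> omega

/-- No seeding has a larger value than the number of variables plus the number of clauses
satisfied by some assignment. -/
theorem exists_tourValue_le {n : ℕ} {cs : List Clause2} (h : Good23 n cs) {l : List ℕ}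
    (hl : IsSeeding (Finset.range (numP n)) l) :
    ∃ α : ℕ → Bool, tourValue (gv1 n cs) (Nat.clog 2 (16 * n)) l ≤ (satCount α cs : ℤ) + n := by
  classical
  set m := Nat.clog 2 (16 * n)
  set f : ℕ → ℕ := (l.getD · 0)
  have hinj : Set.InjOn f (Set.Iio (2 ^ m)) := hl.injOn
  let S : ℕ → Prop := fun i => ∃ q s, (⟨0, q⟩ : Σ _ : ℕ, ℕ) ∈ games m ∧
    Plays f (xPl n i) 0 q ∧ Plays f (litPl n (i, s)) 0 q
  have hα : ∀ i, ∃ b : Bool,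
      (S i → ∃ q, (⟨0, q⟩ : Σ _ : ℕ, ℕ) ∈ games m ∧ Plays f (xPl n i) 0 q ∧
        Plays f (litPl n (i, !b)) 0 q) ∧
      (¬ S i → ∀ t t', t < (lits cs).length → t' < (lits cs).length → (litAt cs t).1 = i →
        (litAt cs t').1 = i → (litAt cs t).2 ≠ b → (litAt cs t').2 ≠ b → t = t') := by
    intro i
    by_cases hS : S i
    · obtain ⟨q, s, h₁, h₂, h₃⟩ := hS
      exact ⟨!s, fun _ => ⟨q, h₁, h₂, by simpa using h₃⟩, fun hn => absurd ⟨q, s, h₁, h₂, h₃⟩ hn⟩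
    · obtain ⟨b, hb⟩ := h.exists_majority i
      exact ⟨b, fun hs => absurd hs hS, fun _ => hb⟩
  choose α hαS hαM using hα
  refine ⟨α, ?_⟩
  rw [tourValue_gv1 _ _ _ _ hl.length_eq, satCount_eq_card]
  set C := (Finset.range cs.length).filter fun k =>
      (litAt cs (2 * k)).2 = α (litAt cs (2 * k)).1 ∨
        (litAt cs (2 * k + 1)).2 = α (litAt cs (2 * k + 1)).1
  -- Clause games won by a false literal concern variables which do not score themselves.
  have hfalse : ∀ {r q t}, (⟨r, q⟩ : Σ _ : ℕ, ℕ) ∈ games m → t < (lits cs).length →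
      Plays f (cPl n (t / 2 + 1)) r q → Plays f (litPl n (litAt cs t)) r q →
      (litAt cs t).2 ≠ α (litAt cs t).1 → ¬ S (litAt cs t).1 := by
    intro r q t hg ht hc hx hne hS
    obtain ⟨q', hg', h₁, h₂⟩ := hαS _ hS
    obtain ⟨h₃, h₄⟩ := h.litAt_mem ht
    have e : litPl n (litAt cs t) = litPl n ((litAt cs t).1, !α (litAt cs t).1) := by
      congr 1
      ext1
      · rfl
      · exact Bool.eq_not_of_ne hne
    rw [e] at hx
    have hlt := litPl_lt_xPl h h₃ h₄ (!α (litAt cs t).1)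
    have hlt' := cPl_lt_litPl h h₃ h₄ (!α (litAt cs t).1) (t / 2)
    obtain rfl := Nat.le_zero.1 (h₂.round_le_of_lt hinj hg' hg h₁ hlt hx)
    obtain rfl := hx.unique hinj hg hg' h₂
    unfold Plays at *
    omega
  let R : (Σ _ : ℕ, ℕ) → ℕ ⊕ ℕ → Prop := fun g x => x.elim
    (fun i => (g.1 = 0 ∧ S i ∧ Plays f (xPl n i) g.1 g.2) ∨
      (¬ S i ∧ ∃ t < (lits cs).length, Plays f (cPl n (t / 2 + 1)) g.1 g.2 ∧
        Plays f (litPl n (litAt cs t)) g.1 g.2 ∧ (litAt cs t).1 = i ∧ (litAt cs t).2 ≠ α i))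
    (fun k => ∃ t < (lits cs).length, Plays f (cPl n (t / 2 + 1)) g.1 g.2 ∧
        Plays f (litPl n (litAt cs t)) g.1 g.2 ∧ t / 2 = k)
  have hclause : ∀ {r q r' q' t t'}, (⟨r, q⟩ : Σ _ : ℕ, ℕ) ∈ games m →
      (⟨r', q'⟩ : Σ _ : ℕ, ℕ) ∈ games m → t < (lits cs).length → t' < (lits cs).length →
      Plays f (cPl n (t / 2 + 1)) r q → Plays f (litPl n (litAt cs t)) r q →
      Plays f (cPl n (t' / 2 + 1)) r' q' → Plays f (litPl n (litAt cs t')) r' q' →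
      t / 2 = t' / 2 → (⟨r, q⟩ : Σ _ : ℕ, ℕ) = ⟨r', q'⟩ := by
    intro r q r' q' t t' hg hg' ht ht' h₁ h₂ h₃ h₄ e
    obtain ⟨b₁, b₂⟩ := h.litAt_mem ht
    obtain ⟨b₃, b₄⟩ := h.litAt_mem ht'
    rw [← e] at h₃
    exact h₁.unique_of_lt hinj hg hg' h₂ (cPl_lt_litPl h b₁ b₂ _ _) h₃ h₄
      (cPl_lt_litPl h b₃ b₄ _ _)
  have hcard := Finset.card_le_card_of_forall_subsingleton R
    (s := (games m).filter fun g => Scores n cs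
      (blockMax f g.1 (2 * g.2)) (blockMax f g.1 (2 * g.2 + 1)) g.1)
    (t := (Finset.Icc 1 n).disjSum C) ?_ ?_
  · rw [Finset.card_disjSum, Nat.card_Icc, Nat.add_sub_cancel] at hcard
    rw [add_comm]
    exact_mod_cast hcard
  · rintro ⟨r, q⟩ hg
    obtain ⟨hg, hs⟩ := Finset.mem_filter.1 hg
    rcases hs.cases with ⟨i, s, h₁, h₂, h₃, h₄, h₅⟩ | ⟨t, ht, hc, hx⟩
    · refine ⟨Sum.inl i, by simp [h₁, h₂], Or.inl ⟨h₅, ?_, h₃⟩⟩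
      simp only at h₅
      subst h₅
      exact ⟨q, s, hg, h₃, h₄⟩
    · by_cases hsat : t / 2 ∈ C
      · exact ⟨Sum.inr (t / 2), by simpa using hsat, t, ht, hc, hx, rfl⟩
      · have hne : (litAt cs t).2 ≠ α (litAt cs t).1 := by
          intro e
          apply hsat
          rw [length_lits] at ht
          refine Finset.mem_filter.2 ⟨Finset.mem_range.2 (by omega), ?_⟩
          rcases Nat.mod_two_eq_zero_or_one t with h' | h'
          · rw [show 2 * (t / 2) = t by omega]; exact Or.inl e
          · rw [show 2 * (t / 2) + 1 = t by omega]; exact Or.inr e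
        exact ⟨Sum.inl (litAt cs t).1, by simpa using h.litAt_mem ht,
          Or.inr ⟨hfalse hg ht hc hx hne, t, ht, hc, hx, rfl, hne⟩⟩
  · rintro (i | k) - ⟨r, q⟩ ⟨hg, hR⟩ ⟨r', q'⟩ ⟨hg', hR'⟩
    · replace hg := (Finset.mem_filter.1 hg).1
      replace hg' := (Finset.mem_filter.1 hg').1
      rcases hR with ⟨h₁, h₂, h₃⟩ | ⟨h₁, t, ht, h₂, h₃, h₄, h₅⟩ <;>
        rcases hR' with ⟨k₁, k₂, k₃⟩ | ⟨k₁, t', kt, k₂, k₃, k₄, k₅⟩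
      · simp only at h₁ k₁
        subst h₁ k₁
        rw [h₃.unique hinj hg hg' k₃]
      · exact absurd h₂ k₁
      · exact absurd k₂ h₁
      · have e := hαM i h₁ t t' ht kt h₄ k₄ h₅ k₅
        exact hclause hg hg' ht kt h₂ h₃ k₂ k₃ (by rw [e])
    · replace hg := (Finset.mem_filter.1 hg).1
      replace hg' := (Finset.mem_filter.1 hg').1
      obtain ⟨t, ht, h₁, h₂, h₃⟩ := hR
      obtain ⟨t', ht', k₁, k₂, k₃⟩ := hR'
      exact hclause hg hg' ht ht' h₁ h₂ k₁ k₂ (h₃.trans k₃.symm)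

/-- An occurrence of a literal in the `k`-th clause, satisfied by `α` if possible. -/
def chosenOcc (cs : List Clause2) (α : ℕ → Bool) (k : ℕ) : ℕ :=
  if (litAt cs (2 * k)).2 = α (litAt cs (2 * k)).1 then 2 * k else 2 * k + 1

theorem chosenOcc_div (cs : List Clause2) (α : ℕ → Bool) (k : ℕ) : chosenOcc cs α k / 2 = k := by
  unfold chosenOcc; split_ifs <;> omega

theorem chosenOcc_lt {cs : List Clause2} (α : ℕ → Bool) {k : ℕ} (hk : k < cs.length) :
    chosenOcc cs α k < (lits cs).length := by
  rw [length_lits]; unfold chosenOcc; split_ifs <;> omega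

/-- The seed position of the player of strength rank `ρ` in the seeding built from `α`. -/
def place (n : ℕ) (cs : List Clause2) (α : ℕ → Bool) (ρ : ℕ) : ℕ :=
  if ρ ≤ 3 * n then
    16 * ((ρ + 2) / 3 - 1) +
      (if ρ % 3 = 1 then 8 else if ρ % 3 = 2 ↔ α ((ρ + 2) / 3) = true then 0 else 9)
  else
    16 * ((litAt cs (chosenOcc cs α (ρ - 3 * n - 1))).1 - 1) +
      2 ^ prevOcc cs (chosenOcc cs α (ρ - 3 * n - 1))

theorem Good23.two_pow_prevOcc {n : ℕ} {cs : List Clause2} (h : Good23 n cs) {t : ℕ}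
    (ht : t < (lits cs).length) :
    (prevOcc cs t = 0 ∧ 2 ^ prevOcc cs t = 1) ∨ (prevOcc cs t = 1 ∧ 2 ^ prevOcc cs t = 2) ∨
      (prevOcc cs t = 2 ∧ 2 ^ prevOcc cs t = 4) := by
  have := h.prevOcc_le ht
  interval_cases prevOcc cs t <;> simp

theorem place_lt {n : ℕ} {cs : List Clause2} (h : Good23 n cs) (α : ℕ → Bool) {ρ : ℕ}
    (h₁ : 1 ≤ ρ) (h₂ : ρ ≤ 3 * n + cs.length) : place n cs α ρ < 16 * n := by
  unfold place
  split_ifs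
  · omega
  · omega
  · omega
  · have ht := chosenOcc_lt α (show ρ - 3 * n - 1 < cs.length by omega)
    have := h.litAt_mem ht
    have := h.two_pow_prevOcc ht
    omega

theorem place_injOn {n : ℕ} {cs : List Clause2} (h : Good23 n cs) (α : ℕ → Bool) :
    Set.InjOn (place n cs α) (Set.Icc 1 (3 * n + cs.length)) := by
  have hvc : ∀ ρ ρ', 1 ≤ ρ → ρ ≤ 3 * n → 3 * n < ρ' → ρ' ≤ 3 * n + cs.length →
      place n cs α ρ ≠ place n cs α ρ' := by
    intro ρ ρ' h₁ h₂ h₃ h₄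
    have ht := chosenOcc_lt α (show ρ' - 3 * n - 1 < cs.length by omega)
    have := h.two_pow_prevOcc ht
    unfold place
    rw [if_pos h₂, if_neg (show ¬ρ' ≤ 3 * n by omega)]
    split_ifs <;> omega
  rintro ρ ⟨h₁, h₂⟩ ρ' ⟨h₃, h₄⟩ e
  rcases le_or_gt ρ (3 * n) with hρ | hρ <;> rcases le_or_gt ρ' (3 * n) with hρ' | hρ'
  · unfold place at e
    rw [if_pos hρ, if_pos hρ'] at e
    have hi : (ρ + 2) / 3 = (ρ' + 2) / 3 := by split_ifs at e <;> omega
    rw [hi] at e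
    cases hα : α ((ρ' + 2) / 3) <;> simp only [hα] at e <;> split_ifs at e <;> simp_all <;> omega
  · exact absurd e (hvc _ _ h₁ hρ hρ' h₄)
  · exact absurd e.symm (hvc _ _ h₃ hρ' hρ h₂)
  · have ht := chosenOcc_lt α (show ρ - 3 * n - 1 < cs.length by omega)
    have ht' := chosenOcc_lt α (show ρ' - 3 * n - 1 < cs.length by omega)
    have k₁ := h.two_pow_prevOcc ht
    have k₂ := h.two_pow_prevOcc ht'
    have k₃ := h.litAt_mem ht
    have k₄ := h.litAt_mem ht'
    unfold place at e
    rw [if_neg (by omega), if_neg (by omega)] at e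
    have e' := prevOcc_inj ht ht' (by omega) (by omega)
    have d₁ := chosenOcc_div cs α (ρ - 3 * n - 1)
    have d₂ := chosenOcc_div cs α (ρ' - 3 * n - 1)
    rw [e'] at d₁
    omega

theorem blockMax_eq {f : ℕ → ℕ} {r q p : ℕ} (hp : p / 2 ^ r = q)
    (h : ∀ p', p' / 2 ^ r = q → p' ≠ p → f p' ≤ f p) : blockMax f r q = f p := by
  refine le_antisymm ?_ (hp ▸ le_blockMax f r p)
  obtain ⟨p', hp', e⟩ := exists_eq_blockMax f r q
  rw [e]
  by_cases hpp : p' = p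
  · rw [hpp]
  · exact h p' hp' hpp

/-- The seeding built from an assignment `α` has at least the value promised by `α`. -/
theorem exists_le_tourValue {n : ℕ} {cs : List Clause2} (h : Good23 n cs) (α : ℕ → Bool) :
    ∃ l, IsSeeding (Finset.range (numP n)) l ∧
      (satCount α cs : ℤ) + n ≤ tourValue (gv1 n cs) (Nat.clog 2 (16 * n)) l := by
  classical
  obtain ⟨hN, hN'⟩ := h.le_numP
  obtain ⟨l, hl, hls⟩ := exists_isSeeding_extend (numP n)
    (Finset.Ico (numP n - (3 * n + cs.length)) (numP n))
    (fun u hu => Finset.mem_range.2 (Finset.mem_Ico.1 hu).2)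
    (fun u => place n cs α (numP n - u))
    (fun u hu => by
      have hu := Finset.mem_Ico.1 hu
      exact (place_lt h α (by omega) (by omega)).trans_le hN)
    (by
      intro u hu u' hu' e
      have hu := Finset.mem_Ico.1 hu
      have hu' := Finset.mem_Ico.1 hu'
      have := place_injOn h α (show numP n - u ∈ Set.Icc 1 _ from ⟨by omega, by omega⟩)
        (show numP n - u' ∈ Set.Icc 1 _ from ⟨by omega, by omega⟩) e
      omega)
  refine ⟨l, hl, ?_⟩
  set f : ℕ → ℕ := (l.getD · 0)
  have hplace : ∀ ρ, 1 ≤ ρ → ρ ≤ 3 * n + cs.length → f (place n cs α ρ) = numP n - ρ := by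
    intro ρ h₁ h₂
    have := hls (numP n - ρ) (Finset.mem_Ico.2 ⟨by omega, by omega⟩)
    rwa [show numP n - (numP n - ρ) = ρ by omega] at this
  have hdummy : ∀ p < numP n, f p + (3 * n + cs.length) < numP n ∨
      ∃ ρ, 1 ≤ ρ ∧ ρ ≤ 3 * n + cs.length ∧ p = place n cs α ρ ∧ f p = numP n - ρ := by
    intro p hp
    by_cases hd : f p + (3 * n + cs.length) < numP n
    · exact Or.inl hd
    · have hfp : f p < numP n := hl.getD_lt hp
      have e := hplace (numP n - f p) (by omega) (by omega)
      refine Or.inr ⟨numP n - f p, by omega, by omega, ?_, by omega⟩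
      refine hl.injOn hp ((place_lt h α (by omega) (by omega)).trans_le hN) ?_
      change f p = f _
      omega
  have hx : ∀ i, 1 ≤ i → i ≤ n → f (16 * (i - 1) + 8) = xPl n i := by
    intro i h₁ h₂
    rw [xPl, ← hplace (3 * i - 2) (by omega) (by omega), place, if_pos (by omega),
      if_pos (by omega), show (3 * i - 2 + 2) / 3 = i by omega]
  have hlit : ∀ i, 1 ≤ i → i ≤ n → f (16 * (i - 1)) = litPl n (i, α i) ∧
      f (16 * (i - 1) + 9) = litPl n (i, !α i) := by
    intro i h₁ h₂
    have e₁ := hplace (3 * i - 1) (by omega) (by omega)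
    have e₂ := hplace (3 * i) (by omega) (by omega)
    rw [place, if_pos (by omega), if_neg (by omega), show (3 * i - 1 + 2) / 3 = i by omega] at e₁
    rw [place, if_pos (by omega), if_neg (by omega), show (3 * i + 2) / 3 = i by omega] at e₂
    have m₁ : (3 * i - 1) % 3 = 2 := by omega
    have m₂ : (3 * i) % 3 = 0 := by omega
    cases hα : α i <;> simp [hα, m₁] at e₁ e₂ <;> simp [litPl, xTPl, xFPl, e₁, e₂]
  have hsmall : ∀ p i, 1 ≤ i → i ≤ n → 16 * (i - 1) < p → p < 16 * (i - 1) + 8 →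
      f p + 3 * n < numP n ∧ (p ≠ 16 * (i - 1) + 1 → p ≠ 16 * (i - 1) + 2 →
        p ≠ 16 * (i - 1) + 4 → f p + (3 * n + cs.length) < numP n) := by
    intro p i h₁ h₂ h₃ h₄
    rcases hdummy p (by omega) with hd | ⟨ρ, r₁, r₂, r₃, r₄⟩
    · exact ⟨by omega, fun _ _ _ => hd⟩
    · have hρ : 3 * n < ρ := by
        by_contra! hρ
        unfold place at r₃
        rw [if_pos hρ] at r₃
        split_ifs at r₃ <;> omega
      refine ⟨by omega, ?_⟩
      have := h.two_pow_prevOcc (chosenOcc_lt α (show ρ - 3 * n - 1 < cs.length by omega))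
      unfold place at r₃
      rw [if_neg (by omega)] at r₃
      omega
  have hvarGame : ∀ i, 1 ≤ i → i ≤ n →
      (⟨0, 8 * (i - 1) + 4⟩ : Σ _ : ℕ, ℕ) ∈ games (Nat.clog 2 (16 * n)) ∧
      Scores n cs (blockMax f 0 (2 * (8 * (i - 1) + 4))) (blockMax f 0 (2 * (8 * (i - 1) + 4) + 1))
        0 := by
    intro i h₁ h₂
    constructor
    · refine mem_games_of_mul_lt (Nat.clog_pos (by norm_num) (by omega)) ?_
      change _ < numP n
      omega
    · refine Or.inl (gv1Core_iff.2 (Or.inl ⟨i, !α i, h₁, h₂, ?_, ?_, rfl⟩))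
      · rw [← hx i h₁ h₂, blockMax]; congr 1; omega
      · rw [← (hlit i h₁ h₂).2, blockMax]; congr 1; omega
  have hclauseGame : ∀ k t, k < cs.length → t = chosenOcc cs α k →
      (litAt cs t).2 = α (litAt cs t).1 →
      (⟨prevOcc cs t, 2 ^ (3 - prevOcc cs t) * ((litAt cs t).1 - 1)⟩ : Σ _ : ℕ, ℕ) ∈
        games (Nat.clog 2 (16 * n)) ∧
      Scores n cs (blockMax f (prevOcc cs t) (2 * (2 ^ (3 - prevOcc cs t) * ((litAt cs t).1 - 1))))
        (blockMax f (prevOcc cs t) (2 * (2 ^ (3 - prevOcc cs t) * ((litAt cs t).1 - 1)) + 1))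
        (prevOcc cs t) := by
    intro k t hk hkt hsat
    have ht : t < (lits cs).length := hkt ▸ chosenOcc_lt α hk
    have hdiv : t / 2 = k := hkt ▸ chosenOcc_div cs α k
    obtain ⟨h₁, h₂⟩ := h.litAt_mem ht
    have hocc := h.prevOcc_le ht
    have h4 : 4 ≤ Nat.clog 2 (16 * n) := by
      by_contra! hc
      have hle : numP n ≤ 2 ^ 3 := Nat.pow_le_pow_right (by norm_num) (by omega)
      omega
    have hc : f (16 * ((litAt cs t).1 - 1) + 2 ^ prevOcc cs t) = cPl n (t / 2 + 1) := by
      rw [cPl, ← hplace (3 * n + (t / 2 + 1)) (by omega) (by omega), place, if_neg (by omega),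
        show 3 * n + (t / 2 + 1) - 3 * n - 1 = k by omega, ← hkt]
    have hx' : f (16 * ((litAt cs t).1 - 1)) = litPl n (litAt cs t) := by
      rw [(hlit _ h₁ h₂).1, ← hsat]
    have hxge : numP n - 3 * n ≤ f (16 * ((litAt cs t).1 - 1)) := by
      rw [hx', litPl]
      split_ifs
      · rw [xTPl]; omega
      · rw [xFPl]; omega
    have hcge : numP n ≤ f (16 * ((litAt cs t).1 - 1) + 2 ^ prevOcc cs t) + (3 * n + cs.length) := by
      rw [hc, cPl]; omega
    have key := fun p => hsmall p _ h₁ h₂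
    constructor
    · refine mem_games_of_mul_lt (by omega) ?_
      change _ < numP n
      interval_cases prevOcc cs t <;> norm_num <;> omega
    · refine Or.inr (gv1Core_iff.2 (Or.inr ⟨t, ht, ?_, ?_, rfl⟩))
      · rw [← hc]
        apply blockMax_eq
        · interval_cases prevOcc cs t <;> norm_num <;> omega
        · intro p hp hne
          have := key p
          interval_cases prevOcc cs t <;> norm_num at hp hne hcge ⊢ <;> omega
      · rw [← hx']
        apply blockMax_eq
        · interval_cases prevOcc cs t <;> norm_num <;> omega
        · intro p hp hne
          have := key p
          interval_cases prevOcc cs t <;> norm_num at hp hne ⊢ <;> omega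
  rw [tourValue_gv1 _ _ _ _ hl.length_eq, satCount_eq_card]
  set C := (Finset.range cs.length).filter fun k =>
      (litAt cs (2 * k)).2 = α (litAt cs (2 * k)).1 ∨
        (litAt cs (2 * k + 1)).2 = α (litAt cs (2 * k + 1)).1
  have hCmem : ∀ k ∈ C, k < cs.length ∧
      (litAt cs (chosenOcc cs α k)).2 = α (litAt cs (chosenOcc cs α k)).1 := by
    intro k hk
    obtain ⟨h₁, h₂⟩ := Finset.mem_filter.1 hk
    refine ⟨Finset.mem_range.1 h₁, ?_⟩
    unfold chosenOcc
    split_ifs with h₃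
    · exact h₃
    · exact h₂.resolve_left h₃
  let F : ℕ ⊕ ℕ → Σ _ : ℕ, ℕ := Sum.elim (fun i => ⟨0, 8 * (i - 1) + 4⟩)
    (fun k => ⟨prevOcc cs (chosenOcc cs α k),
      2 ^ (3 - prevOcc cs (chosenOcc cs α k)) * ((litAt cs (chosenOcc cs α k)).1 - 1)⟩)
  have hcard := Finset.card_le_card_of_injOn (s := (Finset.Icc 1 n).disjSum C)
    (t := (games (Nat.clog 2 (16 * n))).filter fun g => Scores n cs
      (blockMax f g.1 (2 * g.2)) (blockMax f g.1 (2 * g.2 + 1)) g.1) F ?_ ?_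
  · rw [Finset.card_disjSum, Nat.card_Icc, Nat.add_sub_cancel] at hcard
    rw [add_comm]
    exact_mod_cast hcard
  · rintro (i | k) hx
    · have hi := Finset.mem_Icc.1 (Finset.inl_mem_disjSum.1 hx)
      exact Finset.mem_filter.2 (hvarGame i hi.1 hi.2)
    · have hk := hCmem k (Finset.inr_mem_disjSum.1 hx)
      exact Finset.mem_filter.2 (hclauseGame k _ hk.1 rfl hk.2)
  · have hne : ∀ i k, F (Sum.inl i) ≠ F (Sum.inr k) := by
      intro i k e
      simp only [F, Sum.elim_inl, Sum.elim_inr, Sigma.mk.injEq, heq_eq_eq] at e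
      rw [← e.1] at e
      omega
    rintro (i | k) hx (i' | k') hx' e
    · have hi := Finset.mem_Icc.1 (Finset.inl_mem_disjSum.1 hx)
      have hi' := Finset.mem_Icc.1 (Finset.inl_mem_disjSum.1 hx')
      simp only [F, Sum.elim_inl, Sigma.mk.injEq, heq_eq_eq] at e
      congr 1
      omega
    · exact absurd e (hne _ _)
    · exact absurd e.symm (hne _ _)
    · have ht := chosenOcc_lt α (hCmem k (Finset.inr_mem_disjSum.1 hx)).1
      have ht' := chosenOcc_lt α (hCmem k' (Finset.inr_mem_disjSum.1 hx')).1
      simp only [F, Sum.elim_inr, Sigma.mk.injEq, heq_eq_eq] at e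
      obtain ⟨e₁, e₂⟩ := e
      rw [e₁] at e₂
      have e₃ := Nat.eq_of_mul_eq_mul_left (by positivity) e₂
      have := h.litAt_mem ht
      have := h.litAt_mem ht'
      have e₄ := prevOcc_inj ht ht' (by omega) e₁
      rw [← chosenOcc_div cs α k, ← chosenOcc_div cs α k', e₄]

/-- The maximum tournament value over all seedings of the
Construction 1 instance `T_φ` equals the maximum number `M` of simultaneously
satisfiable clauses of the (2,3)-CNF formula `φ` plus `n`. -/
theorem stmt_7 (n : ℕ) (cs : List Clause2) (hgood : Good23 n cs)
    (M : ℕ) (hM : IsGreatest {k : ℕ | ∃ α : ℕ → Bool, satCount α cs = k} M) :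
    IsGreatest {V : ℤ | ∃ l : List ℕ, IsSeeding (Finset.range (numP n)) l ∧
        tourValue (gv1 n cs) (Nat.clog 2 (16 * n)) l = V} ((M : ℤ) + n) := by
  obtain ⟨⟨α, hα⟩, hmax⟩ := hM
  have hle : ∀ l, IsSeeding (Finset.range (numP n)) l →
      tourValue (gv1 n cs) (Nat.clog 2 (16 * n)) l ≤ (M : ℤ) + n := by
    intro l hl
    obtain ⟨β, hβ⟩ := exists_tourValue_le hgood hl
    have : satCount β cs ≤ M := hmax ⟨β, rfl⟩
    omega
  constructor
  · obtain ⟨l, hl, hv⟩ := exists_le_tourValue hgood α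
    exact ⟨l, hl, le_antisymm (hle l hl) (hα ▸ hv)⟩
  · rintro V ⟨l, hl, rfl⟩
    exact hle l hl
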